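/- arXiv:1803.03147 — 6 statements merged into one kernel-verified Lean document; each statement's English description precedes it below -/
import Mathlib

section
/- Let G be a finite simple graph on n vertices and let A_G be the n×n matrix with a_{ij} = 1 if i = j or ij ∈ E(G), and a_{ij} = 0 otherwise. If A_G is totally unimodular, then for every positive integer k, L_{k}(G) = k · L_{1}(G). -/
open Finset SimpleGraph
open scoped Classical

/-- `f` is a `{k}`-packing function of `G`: the sum of `f` over every closed
neighborhood `N[v] = N(v) ∪ {v}` is at most `k`. -/
def IsKPackingFunction {V : Type*} [Fintype V] (G : SimpleGraph V) (k : ℕ) (f : V → ℕ) : Prop :=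
  ∀ v : V, ∑ u ∈ insert v (G.neighborFinset v), f u ≤ k

/-- `L_{k}(G)`: the maximum of `∑ v, f v` over all `{k}`-packing functions `f` of `G`. -/
noncomputable def packingFunctionNumber {V : Type*} [Fintype V] (G : SimpleGraph V) (k : ℕ) : ℕ :=
  sSup {s : ℕ | ∃ f : V → ℕ, IsKPackingFunction G k f ∧ s = ∑ v, f v}

/-- `Z*_rlx(G)`: the optimum of the LP relaxation of the `{1}`-packing problem. -/
noncomputable def Zrlx {V : Type*} [Fintype V] (G : SimpleGraph V) : ℝ :=
  sSup {s : ℝ | ∃ f : V → ℝ, (∀ v, 0 ≤ f v) ∧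
    (∀ v : V, ∑ u ∈ insert v (G.neighborFinset v), f u ≤ 1) ∧ s = ∑ v, f v}

/-- The matrix `A_G` with `a_{ij} = 1` iff `i = j` or `ij ∈ E(G)`, and `0` otherwise. -/
noncomputable def closedAdjMatrix {V : Type*} [Fintype V] (G : SimpleGraph V) : Matrix V V ℝ :=
  fun i j => if i = j ∨ G.Adj i j then 1 else 0

namespace Matrix

variable {m n : Type*} [Fintype n]

/-- A matrix over a field with injective `mulVec` has an invertible square submatrix consisting of
some of its rows. -/
theorem exists_isUnit_submatrix_of_mulVec_injective {K : Type*} [Field K] [Finite m]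
    (B : Matrix m n K) (hB : Function.Injective B.mulVec) :
    ∃ f : n → m, IsUnit (B.submatrix f id) := by
  have := Fintype.ofFinite m
  obtain ⟨κ, a, ha, hspan, hli⟩ := exists_linearIndependent' K B.row
  have := Finite.of_injective a ha
  have := Fintype.ofFinite κ
  have hrank : B.rank = Fintype.card n := by
    rw [← rank_transpose]
    exact (mulVec_injective_iff.mp hB : LinearIndependent K B.col).rank_matrix
  have hcard : Fintype.card κ = Fintype.card n := by
    rw [← hrank, rank_eq_finrank_span_row, ← hspan, finrank_span_eq_card hli]
  let e := Fintype.equivOfCardEq hcard.symm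
  exact ⟨a ∘ e, linearIndependent_rows_iff_isUnit.mp (hli.comp e e.injective)⟩

/-- The solution of an invertible totally unimodular system with integral right-hand side is
integral. -/
theorem IsTotallyUnimodular.exists_int_eq_of_mulVec_eq {A : Matrix n n ℝ}
    (hA : A.IsTotallyUnimodular) (hunit : IsUnit A) {b : n → ℤ} {x : n → ℝ}
    (hx : A *ᵥ x = fun i => (b i : ℝ)) : ∃ y : n → ℤ, x = fun j => (y j : ℝ) := by
  choose s hs using hA.apply
  let M : Matrix n n ℤ := fun i j => (s i j : ℤ)
  have hM : M.map (Int.castRingHom ℝ) = A := by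
    ext i j
    rw [← hs i j]
    change ((s i j : ℤ) : ℝ) = s i j
    cases s i j <;> simp
  have hdet : ((M.det : ℤ) : ℝ) = A.det := by
    rw [← hM]
    exact (Int.castRingHom ℝ).map_det M
  have hMdet : IsUnit M.det := by
    obtain ⟨t, ht⟩ := (isTotallyUnimodular_iff_fintype A).mp hA n id id
    rw [submatrix_id_id, ← hdet] at ht
    have h0 : M.det ≠ 0 := by
      intro h
      rw [isUnit_iff_isUnit_det, ← hdet, h] at hunit
      simp at hunit
    have ht' : M.det = (t : ℤ) := by
      rw [← Int.cast_inj (α := ℝ), ← ht]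
      cases t <;> simp
    rw [ht'] at h0 ⊢
    cases t <;> simp_all
  refine ⟨M⁻¹ *ᵥ b, mulVec_injective_iff_isUnit.mpr hunit ?_⟩
  have h := (Int.castRingHom ℝ).map_mulVec M (M⁻¹ *ᵥ b)
  rw [mulVec_mulVec, mul_nonsing_inv _ hMdet, one_mulVec, hM] at h
  rw [hx]
  exact funext h

/-- Extreme points of `{x | 0 ≤ x ∧ A *ᵥ x ≤ b}` are integral when `A` is totally unimodular and
`b` is integral. -/
theorem IsTotallyUnimodular.exists_int_eq_of_mem_extremePoints [Finite m] {A : Matrix m n ℝ}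
    (hA : A.IsTotallyUnimodular) (b : m → ℤ) {x : n → ℝ}
    (hx : x ∈ Set.extremePoints ℝ {x : n → ℝ | 0 ≤ x ∧ A *ᵥ x ≤ fun i => (b i : ℝ)}) :
    ∃ y : n → ℤ, x = fun j => (y j : ℝ) := by
  obtain ⟨⟨hx0, hxb⟩, hext⟩ := hx
  let B := A.submatrix (Subtype.val : {i // (A *ᵥ x) i = b i} → m)
    (Subtype.val : {j // 0 < x j} → n)
  have hmul : ∀ (i : m) (w : n → ℝ), (∀ j, ¬ 0 < x j → w j = 0) →
      (A *ᵥ w) i = ∑ j : {j // 0 < x j}, A i j * w j := by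
    intro i w hw
    refine (Fintype.sum_of_injective _ Subtype.val_injective _ _ (fun j hj => ?_)
      fun _ => rfl).symm
    rw [hw j (by simpa using hj), mul_zero]
  have hB : Function.Injective B.mulVec := by
    refine (injective_iff_map_eq_zero B.mulVecLin).mpr fun d hd => ?_
    let w : n → ℝ := fun j => if h : 0 < x j then d ⟨j, h⟩ else 0
    have hw : ∀ j : {j // 0 < x j}, w j = d j := fun j => dif_pos j.2
    have htight : ∀ i, (A *ᵥ x) i = b i → (A *ᵥ w) i = 0 := by
      intro i hi
      rw [hmul i w fun j hj => dif_neg hj]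
      simp only [hw]
      exact congrFun hd ⟨i, hi⟩
    have hev : ∀ᶠ ε : ℝ in nhds 0,
        x + ε • w ∈ {x : n → ℝ | 0 ≤ x ∧ A *ᵥ x ≤ fun i => (b i : ℝ)} := by
      simp only [Set.mem_ofPred_eq, Pi.le_def, mulVec_add, mulVec_smul, Pi.add_apply,
        Pi.smul_apply, Pi.zero_apply, smul_eq_mul]
      refine (Filter.eventually_all.mpr fun j => ?_).and (Filter.eventually_all.mpr fun i => ?_)
      · by_cases hj : 0 < x j
        · have hc : Continuous fun ε : ℝ => x j + ε * w j := by fun_prop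
          filter_upwards [continuousAt_const.eventually_lt (f := fun _ => (0 : ℝ))
            hc.continuousAt (by simpa using hj)] with ε hε using hε.le
        · simpa [w, hj] using hx0 j
      · by_cases hi : (A *ᵥ x) i = b i
        · simp [htight i hi, hi]
        · have hc : Continuous fun ε : ℝ => (A *ᵥ x) i + ε * (A *ᵥ w) i := by fun_prop
          filter_upwards [hc.continuousAt.eventually_lt (g := fun _ => (b i : ℝ))
            continuousAt_const (by simpa using lt_of_le_of_ne (hxb i) hi)] with ε hε using hε.le
    obtain ⟨δ, hδ, hball⟩ := Metric.eventually_nhds_iff.mp hev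
    have hpos := hball (y := δ / 2) (by simp [abs_of_pos hδ, hδ])
    have hneg := hball (y := -(δ / 2)) (by simp [abs_of_pos hδ, hδ])
    have heq := hext hpos hneg
      ⟨1 / 2, 1 / 2, by norm_num, by norm_num, by norm_num, by module⟩
    have hw0 : w = 0 := by simpa [hδ.ne'] using heq
    ext j
    rw [← hw j, hw0]
    rfl
  obtain ⟨f, hf⟩ := exists_isUnit_submatrix_of_mulVec_injective B hB
  obtain ⟨y, hy⟩ := (hA.submatrix (Subtype.val ∘ f) Subtype.val).exists_int_eq_of_mulVec_eq hf
    (b := fun j => b (f j)) (x := fun j => x j) <| by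
      ext j
      rw [← (f j).2, hmul (f j) x fun j hj => le_antisymm (not_lt.mp hj) (hx0 j)]
      rfl
  refine ⟨fun j => if h : 0 < x j then y ⟨j, h⟩ else 0, ?_⟩
  ext j
  by_cases hj : 0 < x j
  · simpa [hj] using congrFun hy ⟨j, hj⟩
  · simpa [hj] using le_antisymm (not_lt.mp hj) (hx0 j)

/-- A linear functional on a bounded polyhedron `{x | 0 ≤ x ∧ A *ᵥ x ≤ b}`, with `A` totally
unimodular and `b` integral, is maximised at an integral point. -/
theorem IsTotallyUnimodular.exists_int_le_of_isBounded [Finite m] {A : Matrix m n ℝ}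
    (hA : A.IsTotallyUnimodular) (b : m → ℤ)
    (hbdd : Bornology.IsBounded {x : n → ℝ | 0 ≤ x ∧ A *ᵥ x ≤ fun i => (b i : ℝ)})
    (l : (n → ℝ) →L[ℝ] ℝ) {x : n → ℝ} (hx0 : 0 ≤ x) (hxb : A *ᵥ x ≤ fun i => (b i : ℝ)) :
    ∃ y : n → ℤ, 0 ≤ (fun j => (y j : ℝ)) ∧ (A *ᵥ fun j => (y j : ℝ)) ≤ (fun i => (b i : ℝ)) ∧
      l x ≤ l fun j => (y j : ℝ) := by
  set P := {x : n → ℝ | 0 ≤ x ∧ A *ᵥ x ≤ fun i => (b i : ℝ)} with hP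
  have hclosed : IsClosed P :=
    (isClosed_le continuous_const continuous_id).inter
      (isClosed_le (continuous_const.matrix_mulVec continuous_id) continuous_const)
  have hcompact : IsCompact P := Metric.isCompact_of_isClosed_isBounded hclosed hbdd
  have hexp : IsExposed ℝ P (l.toExposed P) := ContinuousLinearMap.toExposed.isExposed
  obtain ⟨z, hzP, hz⟩ := hcompact.exists_isMaxOn ⟨x, hx0, hxb⟩ l.continuous.continuousOn
  obtain ⟨p, hp⟩ := (hexp.isCompact hcompact).extremePoints_nonempty ⟨z, hzP, fun y hy => hz hy⟩
  obtain ⟨y, rfl⟩ := hA.exists_int_eq_of_mem_extremePoints b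
    (hexp.isExtreme.extremePoints_subset_extremePoints hp)
  exact ⟨y, hp.1.1.1, hp.1.1.2, hp.1.2 x ⟨hx0, hxb⟩⟩

end Matrix

section Packing

variable {V : Type*} [Fintype V] {G : SimpleGraph V} {k : ℕ} {f : V → ℕ}

open Matrix

theorem closedAdjMatrix_mulVec (G : SimpleGraph V) (x : V → ℝ) (v : V) :
    (closedAdjMatrix G *ᵥ x) v = ∑ u ∈ insert v (G.neighborFinset v), x u := by
  simp only [mulVec, dotProduct, closedAdjMatrix, ite_mul, one_mul, zero_mul, ← Finset.sum_filter]
  congr 1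
  ext u
  simp [eq_comm]

theorem le_closedAdjMatrix_mulVec (G : SimpleGraph V) {x : V → ℝ} (hx : 0 ≤ x) :
    x ≤ closedAdjMatrix G *ᵥ x := fun v => by
  rw [closedAdjMatrix_mulVec]
  exact Finset.single_le_sum (fun u _ => hx u) (Finset.mem_insert_self _ _)

theorem isKPackingFunction_iff_mulVec_le :
    IsKPackingFunction G k f ↔ closedAdjMatrix G *ᵥ (fun v => (f v : ℝ)) ≤ fun _ => (k : ℝ) := by
  simp only [IsKPackingFunction, Pi.le_def, closedAdjMatrix_mulVec]
  exact_mod_cast Iff.rfl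

theorem IsKPackingFunction.sum_le (hf : IsKPackingFunction G k f) :
    ∑ v, f v ≤ Fintype.card V * k :=
  Finset.sum_le_card_nsmul _ _ _ fun v _ =>
    (Finset.single_le_sum (fun _ _ => Nat.zero_le _) (Finset.mem_insert_self _ _)).trans (hf v)

theorem IsKPackingFunction.mul (hf : IsKPackingFunction G 1 f) (k : ℕ) :
    IsKPackingFunction G k fun v => k * f v := fun v => by
  rw [← Finset.mul_sum]
  exact mul_le_of_le_one_right' (hf v)

theorem bddAbove_packing (G : SimpleGraph V) (k : ℕ) :
    BddAbove {s : ℕ | ∃ f : V → ℕ, IsKPackingFunction G k f ∧ s = ∑ v, f v} :=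
  ⟨Fintype.card V * k, by rintro _ ⟨f, hf, rfl⟩; exact hf.sum_le⟩

theorem IsKPackingFunction.sum_le_packingFunctionNumber (hf : IsKPackingFunction G k f) :
    ∑ v, f v ≤ packingFunctionNumber G k :=
  le_csSup (bddAbove_packing G k) ⟨f, hf, rfl⟩

theorem exists_sum_eq_packingFunctionNumber (G : SimpleGraph V) (k : ℕ) :
    ∃ f : V → ℕ, IsKPackingFunction G k f ∧ packingFunctionNumber G k = ∑ v, f v :=
  Nat.sSup_mem (s := {s : ℕ | ∃ f : V → ℕ, IsKPackingFunction G k f ∧ s = ∑ v, f v})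
    ⟨0, fun _ => 0, fun _ => by simp, by simp⟩ (bddAbove_packing G k)

/-- If `A_G` is totally unimodular, every `{k}`-packing function has weight at most `k` times that
of some `{1}`-packing function. -/
theorem IsKPackingFunction.exists_sum_le_mul (h : (closedAdjMatrix G).IsTotallyUnimodular)
    (hk : 0 < k) (hf : IsKPackingFunction G k f) :
    ∃ g : V → ℕ, IsKPackingFunction G 1 g ∧ ∑ v, f v ≤ k * ∑ v, g v := by
  have hk' : (0 : ℝ) < k := Nat.cast_pos.mpr hk
  let l : (V → ℝ) →L[ℝ] ℝ := ∑ v, ContinuousLinearMap.proj v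
  have hl : ∀ x, l x = ∑ v, x v := fun x => by simp [l]
  have hbdd : Bornology.IsBounded
      {x : V → ℝ | 0 ≤ x ∧ closedAdjMatrix G *ᵥ x ≤ fun _ => ((1 : ℤ) : ℝ)} :=
    (Metric.isBounded_Icc (0 : V → ℝ) (fun _ => ((1 : ℤ) : ℝ))).subset
      fun x hx => ⟨hx.1, (le_closedAdjMatrix_mulVec G hx.1).trans hx.2⟩
  obtain ⟨y, hy0, hy1, hle⟩ := h.exists_int_le_of_isBounded (fun _ => 1) hbdd l
    (x := (k : ℝ)⁻¹ • fun v => (f v : ℝ))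
    (smul_nonneg (by positivity) fun v => Nat.cast_nonneg (f v)) <| by
      rw [mulVec_smul]
      intro v
      have := isKPackingFunction_iff_mulVec_le.mp hf v
      simpa [inv_mul_le_iff₀ hk'] using this
  have hy0' : 0 ≤ y := fun v => Int.cast_nonneg_iff.mp (hy0 v)
  lift y to V → ℕ using hy0'
  refine ⟨y, isKPackingFunction_iff_mulVec_le.mpr (by simpa using hy1), ?_⟩
  simp only [hl, Pi.smul_apply, smul_eq_mul, ← Finset.mul_sum, inv_mul_le_iff₀ hk'] at hle
  exact_mod_cast hle

end Packing

/-- If `A_G` is totally unimodular then `L_{k}(G) = k · L_{1}(G)` for every positive `k`. -/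
theorem packingFunctionNumber_eq_mul_of_totallyUnimodular {V : Type*} [Fintype V]
    (G : SimpleGraph V) (h : (closedAdjMatrix G).IsTotallyUnimodular) (k : ℕ) (hk : 0 < k) :
    packingFunctionNumber G k = k * packingFunctionNumber G 1 := by
  apply le_antisymm
  · obtain ⟨f, hf, hsum⟩ := exists_sum_eq_packingFunctionNumber G k
    obtain ⟨g, hg, hle⟩ := hf.exists_sum_le_mul h hk
    rw [hsum]
    exact hle.trans (Nat.mul_le_mul_left k hg.sum_le_packingFunctionNumber)
  · obtain ⟨f, hf, hsum⟩ := exists_sum_eq_packingFunctionNumber G 1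
    rw [hsum, Finset.mul_sum]
    exact (hf.mul k).sum_le_packingFunctionNumber
end

section
/- For every finite simple graph G there exists a positive integer q such that for every positive integer k₁, L_{k₁·q}(G) = k₁ · q · Z*_rlx(G) (as real numbers). -/
open Finset SimpleGraph
open scoped Classical

/-- Finitely many reals can be simultaneously approximated by their images under a `ℚ`-linear
map `ℝ → ℚ` fixing `1`. -/
theorem exists_rat_linearMap_approx {ι : Type*} [Fintype ι] (f : ι → ℝ) {ε : ℝ} (hε : 0 < ε) :
    ∃ φ : ℝ →ₗ[ℚ] ℚ, φ 1 = 1 ∧ ∀ i, |(φ (f i) : ℝ) - f i| ≤ ε := by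
  have hli : LinearIndepOn ℚ id ({1} : Set ℝ) := LinearIndepOn.singleton one_ne_zero
  let b := Module.Basis.extend hli
  have hb : ∀ j, b j = (j : ℝ) := fun j => Module.Basis.extend_apply_self hli j
  set C : ℝ := ∑ i, ∑ j ∈ (b.repr (f i)).support, |((b.repr (f i) j : ℚ) : ℝ)| with hC
  have hC0 : 0 ≤ C := by positivity
  have hq : ∀ x : ℝ, ∃ q : ℚ, |(q : ℝ) - x| ≤ ε / (C + 1) ∧ (x = 1 → q = 1) := by
    intro x
    by_cases hx : x = 1
    · exact ⟨1, by subst hx; simp; positivity, fun _ => rfl⟩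
    · obtain ⟨q, hq⟩ := exists_rat_near x (show 0 < ε / (C + 1) by positivity)
      exact ⟨q, by rw [abs_sub_comm]; exact hq.le, fun h => absurd h hx⟩
  choose q hq hq1 using hq
  refine ⟨b.constr ℚ (fun j => q (b j)), ?_, fun i => ?_⟩
  · have hmem : (1 : ℝ) ∈ hli.extend (Set.subset_univ _) :=
      hli.subset_extend (Set.subset_univ _) rfl
    have h1 : b ⟨1, hmem⟩ = 1 := hb _
    have h2 := b.constr_basis ℚ (fun j => q (b j)) ⟨1, hmem⟩
    rw [h1] at h2
    rw [h2, hq1 1 rfl]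
  · have hf : ∑ j ∈ (b.repr (f i)).support, ((b.repr (f i) j : ℚ) : ℝ) * b j = f i := by
      have := b.linearCombination_repr (f i)
      rw [Finsupp.linearCombination_apply, Finsupp.sum] at this
      simpa only [Rat.smul_def] using this
    have hφ : ((b.constr ℚ (fun j => q (b j)) (f i) : ℚ) : ℝ)
        = ∑ j ∈ (b.repr (f i)).support, ((b.repr (f i) j : ℚ) : ℝ) * (q (b j) : ℝ) := by
      rw [Module.Basis.constr_apply, Finsupp.sum]
      push_cast [smul_eq_mul]
      rfl
    calc |((b.constr ℚ (fun j => q (b j)) (f i) : ℚ) : ℝ) - f i|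
        = |∑ j ∈ (b.repr (f i)).support, ((b.repr (f i) j : ℚ) : ℝ) * ((q (b j) : ℝ) - b j)| := by
          rw [hφ]
          conv_lhs => rw [← hf]
          simp only [mul_sub, Finset.sum_sub_distrib, hf]
      _ ≤ ∑ j ∈ (b.repr (f i)).support, |((b.repr (f i) j : ℚ) : ℝ)| * (ε / (C + 1)) := by
          refine (Finset.abs_sum_le_sum_abs _ _).trans (Finset.sum_le_sum fun j _ => ?_)
          rw [abs_mul]
          exact mul_le_mul_of_nonneg_left (hq _) (abs_nonneg _)
      _ ≤ C * (ε / (C + 1)) := by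
          rw [← Finset.sum_mul]
          refine mul_le_mul_of_nonneg_right ?_ (by positivity)
          exact Finset.single_le_sum
            (f := fun i => ∑ j ∈ (b.repr (f i)).support, |((b.repr (f i) j : ℚ) : ℝ)|)
            (fun _ _ => by positivity) (Finset.mem_univ i)
      _ ≤ ε := by
          rw [mul_div_assoc', div_le_iff₀ (by positivity)]
          nlinarith

/-- `f` is a fractional packing function of `G`: it is nonnegative and sums to at most `1` over
every closed neighborhood. -/
def IsFractionalPacking {V : Type*} [Fintype V] (G : SimpleGraph V) (f : V → ℝ) : Prop :=
  (∀ v, 0 ≤ f v) ∧ ∀ v, ∑ u ∈ insert v (G.neighborFinset v), f u ≤ 1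

section

variable {V : Type*} [Fintype V] (G : SimpleGraph V)

/-- The maximum total weight of a fractional packing function is attained. -/
theorem exists_isFractionalPacking_forall_sum_le :
    ∃ f, IsFractionalPacking G f ∧ ∀ g, IsFractionalPacking G g → ∑ v, g v ≤ ∑ v, f v := by
  have hclosed : IsClosed {f : V → ℝ | IsFractionalPacking G f} := by
    simp only [IsFractionalPacking, Set.ofPred_and, Set.ofPred_forall]
    exact (isClosed_iInter fun v => isClosed_le (by fun_prop) (by fun_prop)).inter
      (isClosed_iInter fun v => isClosed_le (by fun_prop) (by fun_prop))
  have hsub : {f : V → ℝ | IsFractionalPacking G f} ⊆ Set.Icc 0 1 := fun f hf =>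
    ⟨hf.1, fun v => (Finset.single_le_sum (fun u _ => hf.1 u)
      (Finset.mem_insert_self v (G.neighborFinset v))).trans (hf.2 v)⟩
  have hcompact := isCompact_Icc.of_isClosed_subset hclosed hsub
  obtain ⟨f, hf, hmax⟩ := hcompact.exists_isMaxOn ⟨0, by simp [IsFractionalPacking]⟩
    (show Continuous fun f : V → ℝ => ∑ v, f v by fun_prop).continuousOn
  exact ⟨f, hf, fun g hg => hmax hg⟩

variable {G}

/-- Small perturbations of a fractional packing function that respect its tight constraints are
again fractional packing functions. -/
theorem IsFractionalPacking.exists_pos_add {f : V → ℝ} (hf : IsFractionalPacking G f) :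
    ∃ ε > 0, ∀ h : V → ℝ, (∀ v, |h v| ≤ ε) → (∀ v, f v = 0 → h v = 0) →
      (∀ v, ∑ u ∈ insert v (G.neighborFinset v), f u = 1 →
        ∑ u ∈ insert v (G.neighborFinset v), h u = 0) → IsFractionalPacking G (f + h) := by
  have h1 : ∀ᶠ ε : ℝ in nhdsWithin 0 (Set.Ioi 0), ∀ v, 0 < f v → ε < f v := by
    refine Filter.eventually_all.2 fun v => Filter.eventually_imp_distrib_left.2 fun hv => ?_
    exact nhdsWithin_le_nhds (eventually_lt_nhds hv)
  have h2 : ∀ᶠ ε : ℝ in nhdsWithin 0 (Set.Ioi 0), ∀ v,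
      ∑ u ∈ insert v (G.neighborFinset v), f u < 1 →
        ∑ u ∈ insert v (G.neighborFinset v), (f u + ε) < 1 := by
    refine Filter.eventually_all.2 fun v => Filter.eventually_imp_distrib_left.2 fun hv => ?_
    refine nhdsWithin_le_nhds ?_
    have hc : Continuous fun ε : ℝ => ∑ u ∈ insert v (G.neighborFinset v), (f u + ε) := by
      fun_prop
    exact hc.continuousAt.eventually_lt_const (by simpa using hv)
  obtain ⟨ε, ⟨h1, h2⟩, hε⟩ := ((h1.and h2).and self_mem_nhdsWithin).exists
  refine ⟨ε, hε, fun h hh h0 ht => ⟨fun v => ?_, fun v => ?_⟩⟩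
  · rcases (hf.1 v).eq_or_lt' with hv | hv
    · simp [hv, h0 v hv]
    · have := neg_le_of_abs_le (hh v)
      have := h1 v hv
      simp only [Pi.add_apply]
      linarith
  · rcases (hf.2 v).eq_or_lt with hv | hv
    · simp only [Pi.add_apply, Finset.sum_add_distrib, hv, ht v hv, add_zero, le_refl]
    · refine le_trans (Finset.sum_le_sum fun u _ => ?_) (h2 v hv).le
      simpa using (le_abs_self _).trans (hh u)

variable (G)

/-- The maximum total weight of a fractional packing function is attained at a rational one. -/
theorem exists_rat_isFractionalPacking_forall_sum_le :
    ∃ r : V → ℚ, IsFractionalPacking G (fun v => (r v : ℝ)) ∧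
      ∀ g, IsFractionalPacking G g → ∑ v, g v ≤ ∑ v, (r v : ℝ) := by
  obtain ⟨f, hf, hmax⟩ := exists_isFractionalPacking_forall_sum_le G
  obtain ⟨ε, hε, hadd⟩ := hf.exists_pos_add
  obtain ⟨φ, hφ1, hφ⟩ := exists_rat_linearMap_approx f hε
  have h0 : ∀ v, f v = 0 → (φ (f v) : ℝ) - f v = 0 := fun v hv => by simp [hv]
  have ht : ∀ v, ∑ u ∈ insert v (G.neighborFinset v), f u = 1 →
      ∑ u ∈ insert v (G.neighborFinset v), ((φ (f u) : ℝ) - f u) = 0 := fun v hv => by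
    rw [Finset.sum_sub_distrib, ← Rat.cast_sum, ← map_sum, hv, hφ1]
    simp
  have hpos := hadd (fun v => (φ (f v) : ℝ) - f v) hφ h0 ht
  have hneg := hadd (fun v => -((φ (f v) : ℝ) - f v)) (fun v => by rw [abs_neg]; exact hφ v)
    (fun v hv => by rw [h0 v hv, neg_zero])
    (fun v hv => by rw [Finset.sum_neg_distrib, ht v hv, neg_zero])
  have hsum := hmax _ hneg
  refine ⟨fun v => φ (f v), by simpa [Pi.add_def] using hpos, fun g hg => (hmax g hg).trans ?_⟩
  simp only [Pi.add_apply, Finset.sum_add_distrib, Finset.sum_neg_distrib,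
    Finset.sum_sub_distrib] at hsum
  linarith

end

/-- For every graph `G` there is a positive integer `q` with
`L_{k₁·q}(G) = k₁·q·Z*_rlx(G)` for all positive `k₁`. -/
theorem exists_q_packingFunctionNumber_eq_mul_Zrlx {V : Type*} [Fintype V]
    (G : SimpleGraph V) :
    ∃ q : ℕ, 0 < q ∧ ∀ k₁ : ℕ, 0 < k₁ →
      (packingFunctionNumber G (k₁ * q) : ℝ) = (k₁ : ℝ) * (q : ℝ) * Zrlx G := by
  obtain ⟨r, hr, hmax⟩ := exists_rat_isFractionalPacking_forall_sum_le G
  have hZ : Zrlx G = ∑ v, (r v : ℝ) := by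
    refine IsGreatest.csSup_eq ⟨⟨_, hr.1, hr.2, rfl⟩, ?_⟩
    rintro _ ⟨g, hg0, hg1, rfl⟩
    exact hmax g ⟨hg0, hg1⟩
  have hq : 0 < ∏ v, (r v).den := Finset.prod_pos fun v _ => (r v).den_pos
  have hnum : ∀ v, ∃ n : ℕ, (n : ℝ) = ((∏ v, (r v).den : ℕ) : ℝ) * r v := by
    intro v
    obtain ⟨c, hc⟩ := Finset.dvd_prod_of_mem (fun v => (r v).den) (Finset.mem_univ v)
    have h0 : 0 ≤ r v := Rat.cast_nonneg.1 (hr.1 v)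
    refine ⟨c * (r v).num.toNat, ?_⟩
    have h1 : (((r v).num.toNat : ℕ) : ℚ) = (r v).num := by
      exact_mod_cast Int.toNat_of_nonneg (Rat.num_nonneg.2 h0)
    have h2 := Rat.den_mul_eq_num (r v)
    rw [hc]
    have : ((c * (r v).num.toNat : ℕ) : ℚ) = (((r v).den * c : ℕ) : ℚ) * r v := by
      push_cast
      rw [h1, ← h2]
      ring
    exact_mod_cast this
  choose n hn using hnum
  generalize ∏ v, (r v).den = q at hq hn
  refine ⟨q, hq, fun k hk => ?_⟩
  have hkq : (0 : ℝ) < ((k * q : ℕ) : ℝ) := by exact_mod_cast Nat.mul_pos hk hq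
  have hcast : ∀ s : Finset V,
      ((∑ v ∈ s, k * n v : ℕ) : ℝ) = ((k * q : ℕ) : ℝ) * ∑ v ∈ s, (r v : ℝ) := by
    intro s
    push_cast
    simp only [hn, Finset.mul_sum, mul_assoc]
  have hL : packingFunctionNumber G (k * q) = ∑ v, k * n v := by
    refine IsGreatest.csSup_eq ⟨⟨fun v => k * n v, fun v => ?_, rfl⟩, ?_⟩
    · rw [← Nat.cast_le (α := ℝ), hcast]
      exact mul_le_of_le_one_right hkq.le (hr.2 v)
    · rintro _ ⟨g, hg, rfl⟩
      have h := hmax (fun v => (g v : ℝ) / ((k * q : ℕ) : ℝ))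
        ⟨fun v => by positivity, fun v => by
          rw [← Finset.sum_div, div_le_one hkq]
          exact_mod_cast hg v⟩
      rw [← Finset.sum_div, div_le_iff₀' hkq, ← hcast] at h
      exact_mod_cast h
  rw [hL, hcast, hZ, Nat.cast_mul]
end

section
/- For every finite simple graph G with n vertices and minimum degree δ(G), and every positive integer k, L_{k}(G) ≤ ⌊n·k/(1 + δ(G))⌋. -/
open Finset SimpleGraph
open scoped Classical

/-- Double counting over closed neighborhoods bounds the weight of a packing function. -/
theorem IsKPackingFunction.sum_mul_le {V : Type*} [Fintype V] {G : SimpleGraph V} {k : ℕ}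
    {f : V → ℕ} (hf : IsKPackingFunction G k f) :
    (∑ v, f v) * (1 + G.minDegree) ≤ Fintype.card V * k := by
  calc (∑ v, f v) * (1 + G.minDegree)
      ≤ ∑ u, f u * (insert u (G.neighborFinset u)).card := by
        rw [Finset.sum_mul]
        refine Finset.sum_le_sum fun u _ => Nat.mul_le_mul_left _ ?_
        rw [Finset.card_insert_of_notMem (by simp), G.card_neighborFinset_eq_degree, add_comm]
        exact Nat.add_le_add_right (G.minDegree_le_degree u) 1
    _ = ∑ u, ∑ _v ∈ insert u (G.neighborFinset u), f u := by
        simp only [Finset.sum_const, smul_eq_mul, mul_comm]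
    _ = ∑ v, ∑ u ∈ insert v (G.neighborFinset v), f u := by
        refine Finset.sum_comm' fun u v => ?_
        simp [G.adj_comm u v, eq_comm (a := u)]
    _ ≤ ∑ _v : V, k := Finset.sum_le_sum fun v _ => hf v
    _ = Fintype.card V * k := by simp

/-- `L_{k}(G) ≤ ⌊n·k/(1 + δ(G))⌋`. -/
theorem packingFunctionNumber_le_floor {V : Type*} [Fintype V]
    (G : SimpleGraph V) (k : ℕ) (hk : 0 < k) :
    (packingFunctionNumber G k : ℤ) ≤
      ⌊((Fintype.card V : ℚ) * (k : ℚ)) / (1 + (G.minDegree : ℚ))⌋ := by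
  rw [Int.le_floor, le_div_iff₀ (by positivity)]
  have h : packingFunctionNumber G k ≤ Fintype.card V * k / (1 + G.minDegree) := by
    refine csSup_le' ?_
    rintro _ ⟨f, hf, rfl⟩
    exact (Nat.le_div_iff_mul_le (by omega)).2 hf.sum_mul_le
  exact_mod_cast (Nat.le_div_iff_mul_le (by omega)).1 h
end

section
/- If G is a finite simple graph with n vertices that is regular of degree r, then for every positive integer k, L_{k}(G) ≤ ⌊n·k/(1 + r)⌋. -/
open Finset SimpleGraph
open scoped Classical

/-- Double counting: summing over all closed neighborhoods of an `r`-regular graph counts each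
vertex `r + 1` times. -/
theorem sum_sum_closedNeighborhood_of_regular {V : Type*} [Fintype V]
    (G : SimpleGraph V) (r : ℕ) (hr : G.IsRegularOfDegree r) (f : V → ℕ) :
    ∑ v, ∑ u ∈ insert v (G.neighborFinset v), f u = (r + 1) * ∑ v, f v := by
  have hcomm : ∑ v, ∑ u ∈ insert v (G.neighborFinset v), f u =
      ∑ u, ∑ _v ∈ insert u (G.neighborFinset u), f u := by
    refine Finset.sum_comm' fun v u => ?_
    simp [G.adj_comm, eq_comm]
  rw [hcomm, Finset.mul_sum]
  refine Finset.sum_congr rfl fun u _ => ?_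
  rw [Finset.sum_const, smul_eq_mul,
    Finset.card_insert_of_notMem (by simp), G.card_neighborFinset_eq_degree, hr u]

/-- A `{k}`-packing function of an `r`-regular graph has weight at most `n * k / (r + 1)`. -/
theorem IsKPackingFunction.mul_sum_le_of_regular {V : Type*} [Fintype V]
    {G : SimpleGraph V} {r : ℕ} (hr : G.IsRegularOfDegree r) {k : ℕ} {f : V → ℕ}
    (hf : IsKPackingFunction G k f) : (r + 1) * ∑ v, f v ≤ Fintype.card V * k := by
  rw [← sum_sum_closedNeighborhood_of_regular G r hr f]
  simpa using Finset.sum_le_card_nsmul Finset.univ _ k fun v _ => hf v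

/-- If `G` is regular of degree `r` then `L_{k}(G) ≤ ⌊n·k/(1 + r)⌋`. -/
theorem packingFunctionNumber_le_floor_of_regular {V : Type*} [Fintype V]
    (G : SimpleGraph V) (r : ℕ) (hr : G.IsRegularOfDegree r) (k : ℕ) (hk : 0 < k) :
    (packingFunctionNumber G k : ℤ) ≤
      ⌊((Fintype.card V : ℚ) * (k : ℚ)) / (1 + (r : ℚ))⌋ := by
  have hL : packingFunctionNumber G k ≤ Fintype.card V * k / (r + 1) := by
    refine csSup_le ⟨0, fun _ => 0, fun v => by simp, by simp⟩ ?_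
    rintro s ⟨f, hf, rfl⟩
    rw [Nat.le_div_iff_mul_le r.succ_pos, mul_comm]
    exact hf.mul_sum_le_of_regular hr
  rw [Nat.le_div_iff_mul_le r.succ_pos] at hL
  rw [Int.le_floor, le_div_iff₀ (by positivity), add_comm]
  exact_mod_cast hL
end

section
/- For the cycle graph C_n on n ≥ 3 vertices and every positive integer k, L_{k}(C_n) = ⌊n·k/3⌋. -/
open Finset SimpleGraph
open scoped Classical

/-- In a cycle the closed neighborhood of `v` is `{v - 1, v, v + 1}`, so the packing condition
bounds the sums over three consecutive vertices. -/
theorem isKPackingFunction_cycleGraph_iff {m k : ℕ} {f : Fin (m + 3) → ℕ} :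
    IsKPackingFunction (cycleGraph (m + 3)) k f ↔
      ∀ v, f (v - 1) + f v + f (v + 1) ≤ k := by
  refine forall_congr' fun v => ?_
  have hset : ∀ s : Finset (Fin (m + 3)), (∀ u, u ∈ s ↔ u = v ∨ (cycleGraph (m + 3)).Adj v u) →
      s = {v - 1, v, v + 1} := by
    intro s hs
    ext u
    simp only [hs, mem_insert, mem_singleton, cycleGraph_adj]
    have h₁ : v - u = 1 ↔ u = v - 1 := by
      constructor <;> intro h
      · rw [← h]; abel
      · rw [h]; abel
    rw [h₁, sub_eq_iff_eq_add, add_comm 1 v]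
    tauto
  have htwo : (1 : Fin (m + 3)) + 1 ≠ 0 := by
    simp [Fin.ext_iff, Fin.val_add, Nat.mod_eq_of_lt (show 2 < m + 3 by omega)]
  have h₁ : v - 1 ≠ v := by simp
  have h₂ : v - 1 ≠ v + 1 := by
    intro h
    rw [sub_eq_iff_eq_add, add_assoc] at h
    exact htwo (left_eq_add.mp h)
  have h₃ : v ≠ v + 1 := by simp
  rw [sum_congr (f := f) (hset _ ?_) fun _ _ => rfl, sum_insert (by simp [h₁, h₂]),
    sum_insert (by simp [h₃]), sum_singleton, add_assoc]
  simp

theorem three_mul_sum_le_of_isKPackingFunction {m k : ℕ} {f : Fin (m + 3) → ℕ}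
    (hf : IsKPackingFunction (cycleGraph (m + 3)) k f) : 3 * ∑ v, f v ≤ (m + 3) * k := by
  have hle : ∑ v, (f (v - 1) + f v + f (v + 1)) ≤ ∑ _v : Fin (m + 3), k :=
    sum_le_sum fun v _ => isKPackingFunction_cycleGraph_iff.mp hf v
  have hsub : ∑ v, f (v - 1) = ∑ v, f v := Equiv.sum_comp (Equiv.subRight (1 : Fin (m + 3))) f
  have hadd : ∑ v, f (v + 1) = ∑ v, f v := Equiv.sum_comp (Equiv.addRight (1 : Fin (m + 3))) f
  rw [sum_add_distrib, sum_add_distrib, hsub, hadd] at hle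
  simp only [sum_const, card_univ, Fintype.card_fin, smul_eq_mul] at hle
  omega

/-- The balanced labelling of the vertices of `C_n` with total weight `T`. -/
def balancedLabelling (n T : ℕ) (v : Fin n) : ℕ :=
  (v + 1) * T / n - v * T / n

theorem sum_balancedLabelling {n : ℕ} (hn : 0 < n) (T : ℕ) :
    ∑ v, balancedLabelling n T v = T := by
  have hmono : Monotone fun i : ℕ => i * T / n := fun i j hij =>
    Nat.div_le_div_right (Nat.mul_le_mul_right T hij)
  have hsum := sum_range_tsub hmono n
  simp only [balancedLabelling]
  rw [Fin.sum_univ_eq_sum_range (fun i => (i + 1) * T / n - i * T / n), hsum]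
  simp [Nat.mul_div_cancel_left T hn]

theorem isKPackingFunction_balancedLabelling {m k T : ℕ} (hT : 3 * T ≤ (m + 3) * k) :
    IsKPackingFunction (cycleGraph (m + 3)) k (balancedLabelling (m + 3) T) := by
  rw [isKPackingFunction_cycleGraph_iff]
  intro v
  set g : ℕ → ℕ := fun i => i * T / (m + 3) with hg
  have hval : ∀ u : Fin (m + 3), balancedLabelling (m + 3) T u = g (u + 1) - g u := fun _ => rfl
  have hmono : Monotone g := fun i j hij =>
    Nat.div_le_div_right (Nat.mul_le_mul_right T hij)
  have hwindow : ∀ i, g (i + 3) ≤ g i + k := fun i => by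
    simp only [hg]
    rw [← Nat.add_mul_div_left _ _ (Nat.succ_pos (m + 2))]
    exact Nat.div_le_div_right (by rw [add_mul]; exact Nat.add_le_add_left hT _)
  have hperiod : ∀ i, g (i + (m + 3)) = g i + T := fun i => by
    simp only [hg]
    rw [add_mul, Nat.add_mul_div_left _ _ (Nat.succ_pos (m + 2))]
  have hstep : ∀ i, g i ≤ g (i + 1) := fun i => hmono (Nat.le_succ i)
  have hsub : ((v - 1 : Fin (m + 3)) : ℕ) = if v = 0 then m + 2 else (v : ℕ) - 1 :=
    Fin.coe_sub_one v
  have hadd : ((v + 1 : Fin (m + 3)) : ℕ) = if v = Fin.last _ then 0 else (v : ℕ) + 1 :=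
    Fin.val_add_one v
  rw [hval, hval, hval, hsub, hadd]
  have hzero : g 0 = 0 := by simp [hg]
  have hp0 := hperiod 0
  have hp1 := hperiod 1
  rw [zero_add] at hp0
  rw [add_comm 1] at hp1
  split_ifs with h₀ h₁ h₁
  · exact absurd (h₀.symm.trans h₁) (by simp [Fin.ext_iff])
  · subst h₀
    have := hwindow (m + 2)
    have hp2 := hperiod 2
    have e : m + 2 + 3 = 2 + (m + 3) := by omega
    rw [e] at this
    have := hstep (m + 2)
    have := hstep 0
    have := hstep 1
    simp only [Fin.val_zero, zero_add, Nat.reduceAdd, Nat.add_assoc] at *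
    omega
  · subst h₁
    have := hwindow (m + 1)
    have := hstep (m + 1)
    have := hstep (m + 2)
    have := hstep 0
    simp only [Fin.val_last, zero_add, Nat.reduceAdd, Nat.add_assoc, Nat.add_sub_assoc,
      Nat.reduceLeDiff, Nat.reduceSub] at *
    omega
  · obtain ⟨i, hi⟩ : ∃ i, (v : ℕ) = i + 1 :=
      Nat.exists_eq_succ_of_ne_zero fun h => h₀ (Fin.ext h)
    rw [hi]
    have := hwindow i
    have := hstep i
    have := hstep (i + 1)
    have := hstep (i + 2)
    simp only [Nat.add_sub_cancel, Nat.add_assoc, Nat.reduceAdd] at *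
    omega

/-- For the cycle `C_n` (`n ≥ 3`), `L_{k}(C_n) = ⌊n·k/3⌋`. -/
theorem packingFunctionNumber_cycleGraph {n : ℕ} (hn : 3 ≤ n) (k : ℕ) (hk : 0 < k) :
    (packingFunctionNumber (SimpleGraph.cycleGraph n) k : ℤ) =
      ⌊((n : ℚ) * (k : ℚ)) / 3⌋ := by
  obtain ⟨m, rfl⟩ : ∃ m, n = m + 3 := ⟨n - 3, by omega⟩
  have hmax : IsGreatest {s : ℕ | ∃ f : Fin (m + 3) → ℕ,
      IsKPackingFunction (cycleGraph (m + 3)) k f ∧ s = ∑ v, f v} ((m + 3) * k / 3) := by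
    refine ⟨⟨balancedLabelling (m + 3) ((m + 3) * k / 3),
      isKPackingFunction_balancedLabelling (Nat.mul_div_le _ _),
      (sum_balancedLabelling (Nat.succ_pos _) _).symm⟩, ?_⟩
    rintro s ⟨f, hf, rfl⟩
    rw [Nat.le_div_iff_mul_le three_pos, mul_comm]
    exact three_mul_sum_le_of_isKPackingFunction hf
  rw [packingFunctionNumber, hmax.csSup_eq]
  have hfloor := Rat.floor_intCast_div_natCast (((m + 3) * k : ℕ) : ℤ) 3
  push_cast at hfloor ⊢
  exact hfloor.symm
end

section
/- For the path graph P_n on n ≥ 1 vertices and every positive integer k, L_{k}(P_n) = ⌈n/3⌉ · k. -/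
open Finset SimpleGraph
open scoped Classical

theorem mem_insert_neighborFinset {V : Type*} [Fintype V] (G : SimpleGraph V) {u v : V} :
    u ∈ insert v (G.neighborFinset v) ↔ u = v ∨ G.Adj v u := by
  rw [Finset.mem_insert, mem_neighborFinset]

/-- The vertices of a path split into `⌈n/3⌉` blocks of consecutive vertices. -/
theorem sum_eq_sum_blocks {n : ℕ} (f : Fin n → ℕ) :
    ∑ v, f v = ∑ i ∈ range ((n + 2) / 3), ∑ v with v.val / 3 = i, f v := by
  refine (sum_fiberwise_of_maps_to (fun v _ => ?_) f).symm
  have := v.isLt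
  rw [Finset.mem_range]
  omega

theorem IsKPackingFunction.sum_pathGraph_le {n k : ℕ} {f : Fin n → ℕ}
    (hf : IsKPackingFunction (pathGraph n) k f) : ∑ v, f v ≤ (n + 2) / 3 * k := by
  suffices h : ∀ i ∈ range ((n + 2) / 3), ∑ v with v.val / 3 = i, f v ≤ k by
    rw [sum_eq_sum_blocks]
    simpa using sum_le_card_nsmul _ _ _ h
  intro i hi
  rw [Finset.mem_range] at hi
  refine le_trans (sum_le_sum_of_subset fun u hu => ?_)
    (hf ⟨min (3 * i + 1) (n - 1), by omega⟩)
  rw [mem_insert_neighborFinset, pathGraph_adj, Fin.ext_iff]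
  have hu' : u.val / 3 = i := by simpa using hu
  have := u.isLt
  simp only
  omega

theorem isKPackingFunction_pathGraph (n k : ℕ) :
    IsKPackingFunction (pathGraph n) k fun v => if v.val % 3 = 0 then k else 0 := by
  intro v
  rw [← sum_filter, sum_const, smul_eq_mul]
  refine (Nat.mul_le_mul_right k ?_).trans_eq (one_mul k)
  rw [card_le_one]
  intro a ha b hb
  rw [Finset.mem_filter, mem_insert_neighborFinset, pathGraph_adj, Fin.ext_iff] at ha hb
  ext
  omega

theorem le_sum_pathGraph (n k : ℕ) :
    (n + 2) / 3 * k ≤ ∑ v : Fin n, if v.val % 3 = 0 then k else 0 := by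
  rw [sum_eq_sum_blocks]
  have h : ∀ i ∈ range ((n + 2) / 3),
      k ≤ ∑ v : Fin n with v.val / 3 = i, if v.val % 3 = 0 then k else 0 := by
    intro i hi
    rw [Finset.mem_range] at hi
    have hmem : (⟨3 * i, by omega⟩ : Fin n) ∈ univ.filter fun v : Fin n => v.val / 3 = i := by
      simp
    simpa using single_le_sum
      (f := fun v : Fin n => if v.val % 3 = 0 then k else 0) (fun _ _ => Nat.zero_le _) hmem
  simpa using card_nsmul_le_sum _ _ _ h

theorem packingFunctionNumber_pathGraph_eq (n k : ℕ) :
    packingFunctionNumber (pathGraph n) k = (n + 2) / 3 * k := by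
  refine IsGreatest.csSup_eq ⟨⟨_, isKPackingFunction_pathGraph n k, ?_⟩, ?_⟩
  · exact le_antisymm (le_sum_pathGraph n k) (isKPackingFunction_pathGraph n k).sum_pathGraph_le
  · rintro _ ⟨f, hf, rfl⟩
    exact hf.sum_pathGraph_le

theorem ceil_natCast_div_three (n : ℕ) : ⌈(n : ℚ) / 3⌉ = (((n + 2) / 3 : ℕ) : ℤ) := by
  rw [Int.ceil_eq_iff]
  have h₁ : 3 * ((n + 2) / 3) < n + 3 := by omega
  have h₂ : n ≤ 3 * ((n + 2) / 3) := by omega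
  generalize (n + 2) / 3 = m at h₁ h₂
  have h₁' : 3 * (m : ℚ) < n + 3 := by exact_mod_cast h₁
  have h₂' : (n : ℚ) ≤ 3 * m := by exact_mod_cast h₂
  rw [Int.cast_natCast]
  constructor <;> linarith

/-- For the path `P_n` (`n ≥ 1`), `L_{k}(P_n) = ⌈n/3⌉ · k`. -/
theorem packingFunctionNumber_pathGraph {n : ℕ} (hn : 1 ≤ n) (k : ℕ) (hk : 0 < k) :
    (packingFunctionNumber (SimpleGraph.pathGraph n) k : ℤ) =
      ⌈(n : ℚ) / 3⌉ * (k : ℤ) := by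
  rw [packingFunctionNumber_pathGraph_eq, ceil_natCast_div_three, Nat.cast_mul]
end
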